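/- For every K > 0 there exists a constant C > 0 such that the following holds: for all level-2 α-Hölder rough paths 𝐗 = (X,𝕏) and 𝐗̃ = (X̃,𝕏̃) over V with ‖𝐗‖_α ≤ K and ‖𝐗̃‖_α ≤ K, every 𝐗-controlled rough path 𝐘 = (Y,Y') and every 𝐗̃-controlled rough path 𝐘̃ = (Ỹ,Ỹ') with values in L(W,U), and every 𝐗-controlled rough path 𝐙 = (Z,Z') and every 𝐗̃-controlled rough path 𝐙̃ = (Z̃,Z̃') with values in W, all satisfying ‖Y'_0‖, ‖Ỹ'_0‖, ‖Z'_0‖, ‖Z̃'_0‖ ≤ K and ‖𝐘‖_{𝐗;α}, ‖𝐘̃‖_{𝐗̃;α}, ‖𝐙‖_{𝐗;α}, ‖𝐙̃‖_{𝐗̃;α} ≤ K, and every 0 ≤ s ≤ t ≤ T: ‖ (∫_s^t Y dZ − ∫_s^t Ỹ dZ̃) − (Y_s(Z_{s,t}) + (Y'_s ⋆ Z'_s)(𝕏_{s,t})) + (Ỹ_s(Z̃_{s,t}) + (Ỹ'_s ⋆ Z̃'_s)(𝕏̃_{s,t})) ‖ ≤ C ( d_{𝐗,𝐗̃;α}(𝐘,𝐘̃)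 + d_{𝐗,𝐗̃;α}(𝐙,𝐙̃) + ‖Y'_0 − Ỹ'_0‖ + ‖Z'_0 − Z̃'_0‖ + ‖𝐗 − 𝐗̃‖_α ) (t − s)^{3α}, where ∫_s^t Y dZ and ∫_s^t Ỹ dZ̃ are the rough integrals taken with respect to 𝐗 and 𝐗̃ respectively. -/

import Mathlib

/-!  Common definitions: level-2 rough paths, controlled rough paths,
compensated Riemann sums and rough integrals of a controlled rough path
against another controlled rough path. -/

open scoped BigOperators

noncomputable section

/-- `HBound T β A` : the two-parameter map `A` satisfies a `β`-Hölder bound on the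
simplex `{0 ≤ s < t ≤ T}`. -/
def HBound {E : Type*} [NormedAddCommGroup E] (T β : ℝ) (A : ℝ → ℝ → E) : Prop :=
  ∃ C : ℝ, ∀ s t : ℝ, 0 ≤ s → s < t → t ≤ T → ‖A s t‖ ≤ C * (t - s) ^ β

/-- The Hölder seminorm `‖A‖_β = sup_{0 ≤ s < t ≤ T} ‖A_{s,t}‖ / (t-s)^β`, realised as the
least admissible Hölder constant. -/
def hnorm {E : Type*} [NormedAddCommGroup E] (T β : ℝ) (A : ℝ → ℝ → E) : ℝ :=
  sInf {C : ℝ | 0 ≤ C ∧ ∀ s t : ℝ, 0 ≤ s → s < t → t ≤ T → ‖A s t‖ ≤ C * (t - s) ^ β}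

/-- An abstract model of the projective tensor product `V ⊗̂ V`, bundling the canonical
bounded bilinear map `tmul : V × V → V ⊗̂ V` and the pairing `⋆` sending
`A ∈ L(V, L(W,U))` and `B ∈ L(V,W)` to the induced operator `A ⋆ B ∈ L(V ⊗̂ V, U)`,
characterised by `(A ⋆ B)(v₁ ⊗ v₂) = (A v₁)(B v₂)` and `‖A ⋆ B‖ ≤ ‖A‖ ‖B‖`. -/
structure TensorOps (V V2 W U : Type*)
    [NormedAddCommGroup V] [NormedSpace ℝ V] [NormedAddCommGroup V2] [NormedSpace ℝ V2]
    [NormedAddCommGroup W] [NormedSpace ℝ W] [NormedAddCommGroup U] [NormedSpace ℝ U] where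
  tmul : V →L[ℝ] V →L[ℝ] V2
  tmul_le : ∀ a b : V, ‖tmul a b‖ ≤ ‖a‖ * ‖b‖
  spair : (V →L[ℝ] (W →L[ℝ] U)) →L[ℝ] ((V →L[ℝ] W) →L[ℝ] (V2 →L[ℝ] U))
  spair_tmul : ∀ (A : V →L[ℝ] (W →L[ℝ] U)) (B : V →L[ℝ] W) (a b : V),
    spair A B (tmul a b) = (A a) (B b)
  spair_le : ∀ (A : V →L[ℝ] (W →L[ℝ] U)) (B : V →L[ℝ] W), ‖spair A B‖ ≤ ‖A‖ * ‖B‖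

section Defs

variable {V V2 E : Type*}
  [NormedAddCommGroup V] [NormedSpace ℝ V] [NormedAddCommGroup V2] [NormedSpace ℝ V2]
  [NormedAddCommGroup E] [NormedSpace ℝ E]

/-- `(X, XX)` is a level-2 `α`-Hölder rough path on `[0,T]`:
Chen's relation plus the analytic estimates. -/
structure IsRoughPath (T α : ℝ) (tmul : V →L[ℝ] V →L[ℝ] V2)
    (X : ℝ → V) (XX : ℝ → ℝ → V2) : Prop where
  chen : ∀ s u t : ℝ, 0 ≤ s → s ≤ u → u ≤ t → t ≤ T →
    XX s t = XX s u + XX u t + tmul (X u - X s) (X t - X u)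
  x_hold : HBound T α fun s t => X t - X s
  xx_hold : HBound T (2 * α) XX

/-- `‖𝐗‖_α := ‖X‖_α + ‖𝕏‖_{2α}`. -/
def rpNorm (T α : ℝ) (X : ℝ → V) (XX : ℝ → ℝ → V2) : ℝ :=
  hnorm T α (fun s t => X t - X s) + hnorm T (2 * α) XX

/-- `‖𝐗 − 𝐗̃‖_α := ‖X − X̃‖_α + ‖𝕏 − 𝕏̃‖_{2α}`. -/
def rpDist (T α : ℝ) (X Xt : ℝ → V) (XX XXt : ℝ → ℝ → V2) : ℝ :=
  hnorm T α (fun s t => (X t - X s) - (Xt t - Xt s)) +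
    hnorm T (2 * α) fun s t => XX s t - XXt s t

/-- The remainder `R^{𝐘}_{s,t} := Y_{s,t} − Y'_s(X_{s,t})` of a controlled rough path. -/
def Rem (X : ℝ → V) (Y : ℝ → E) (Y' : ℝ → V →L[ℝ] E) (s t : ℝ) : E :=
  Y t - Y s - Y' s (X t - X s)

/-- `(Y, Y')` is an `𝐗`-controlled rough path on `[0,T]` with values in `E`. -/
structure IsCRP (T α : ℝ) (X : ℝ → V) (Y : ℝ → E) (Y' : ℝ → V →L[ℝ] E) : Prop where
  deriv_hold : HBound T α fun s t => Y' t - Y' s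
  rem_hold : HBound T (2 * α) (Rem X Y Y')

/-- `‖𝐘‖_{𝐗;α} := ‖R^{𝐘}‖_{2α} + ‖Y'‖_α`. -/
def crpNorm (T α : ℝ) (X : ℝ → V) (Y : ℝ → E) (Y' : ℝ → V →L[ℝ] E) : ℝ :=
  hnorm T (2 * α) (Rem X Y Y') + hnorm T α fun s t => Y' t - Y' s

/-- `d_{𝐗,𝐗̃;α}(𝐘,𝐘̃) := ‖R^{𝐘} − R^{𝐘̃}‖_{2α} + ‖Y' − Ỹ'‖_α`. -/
def crpDist (T α : ℝ) (X Xt : ℝ → V) (Y : ℝ → E) (Y' : ℝ → V →L[ℝ] E)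
    (Yt : ℝ → E) (Yt' : ℝ → V →L[ℝ] E) : ℝ :=
  hnorm T (2 * α) (fun s t => Rem X Y Y' s t - Rem Xt Yt Yt' s t) +
    hnorm T α fun s t => (Y' t - Y' s) - (Yt' t - Yt' s)

/-- `p` is a finite partition `s = p 0 < p 1 < ⋯ < p n = t` of `[s,t]`. -/
def IsPartition (s t : ℝ) (n : ℕ) (p : ℕ → ℝ) : Prop :=
  p 0 = s ∧ p n = t ∧ ∀ i < n, p i < p (i + 1)

end Defs

section Sums

variable {V V2 W U : Type*}
  [NormedAddCommGroup V] [NormedSpace ℝ V] [NormedAddCommGroup V2] [NormedSpace ℝ V2]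
  [NormedAddCommGroup W] [NormedSpace ℝ W] [NormedAddCommGroup U] [NormedSpace ℝ U]

/-- The compensated Riemann sum
`∫_P Y dZ := Σ_i [ Y_{t_i}(Z_{t_i,t_{i+1}}) + (Y'_{t_i} ⋆ Z'_{t_i})(𝕏_{t_i,t_{i+1}}) ]`. -/
def rsum (tops : TensorOps V V2 W U) (XX : ℝ → ℝ → V2)
    (Y : ℝ → W →L[ℝ] U) (Y' : ℝ → V →L[ℝ] (W →L[ℝ] U))
    (Z : ℝ → W) (Z' : ℝ → V →L[ℝ] W) (n : ℕ) (p : ℕ → ℝ) : U :=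
  ∑ i ∈ Finset.range n,
    ((Y (p i)) (Z (p (i + 1)) - Z (p i)) +
      (tops.spair (Y' (p i)) (Z' (p i))) (XX (p i) (p (i + 1))))

/-- `I` is the rough integral `∫_s^t Y dZ`: the limit of the compensated Riemann sums
as the mesh of the partition tends to `0`. -/
def IsRoughIntegral (tops : TensorOps V V2 W U) (XX : ℝ → ℝ → V2)
    (Y : ℝ → W →L[ℝ] U) (Y' : ℝ → V →L[ℝ] (W →L[ℝ] U))
    (Z : ℝ → W) (Z' : ℝ → V →L[ℝ] W) (s t : ℝ) (I : U) : Prop :=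
  ∀ ε : ℝ, 0 < ε → ∃ δ : ℝ, 0 < δ ∧ ∀ (n : ℕ) (p : ℕ → ℝ), IsPartition s t n p →
    (∀ i < n, p (i + 1) - p i < δ) → ‖rsum tops XX Y Y' Z Z' n p - I‖ ≤ ε

end Sums

/-- The constant `C_α := (1 + T^α + T^{2α}) · 2^{3α} · Σ_{n≥1} n^{-3α}`. -/
def Calpha (T α : ℝ) : ℝ :=
  (1 + T ^ α + T ^ (2 * α)) * (2 : ℝ) ^ (3 * α) * ∑' n : ℕ, ((n : ℝ) + 1) ^ (-(3 * α))

/-- `F ∈ C_b^k`: `k` times continuously Fréchet differentiable with all derivatives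
up to order `k` bounded. -/
def IsCb {E₁ E₂ : Type*} [NormedAddCommGroup E₁] [NormedSpace ℝ E₁]
    [NormedAddCommGroup E₂] [NormedSpace ℝ E₂] (k : ℕ) (F : E₁ → E₂) : Prop :=
  ContDiff ℝ (k : ℕ∞) F ∧ ∀ j ≤ k, ∃ C : ℝ, ∀ x, ‖iteratedFDeriv ℝ j F x‖ ≤ C

/-- `‖F‖_{C_b^k} := Σ_{j=0}^k sup_x ‖D^j F(x)‖`. -/
def cbNorm {E₁ E₂ : Type*} [NormedAddCommGroup E₁] [NormedSpace ℝ E₁]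
    [NormedAddCommGroup E₂] [NormedSpace ℝ E₂] (k : ℕ) (F : E₁ → E₂) : ℝ :=
  ∑ j ∈ Finset.range (k + 1), ⨆ x : E₁, ‖iteratedFDeriv ℝ j F x‖

end

section Sewing

/-- The points of the uniform partition of `[s, t]` into `2 ^ k` intervals. -/
noncomputable def dyadicPoint (k : ℕ) (s t : ℝ) (i : ℕ) : ℝ :=
  s + i * ((t - s) / 2 ^ k)

lemma dyadicPoint_succ_sub (k : ℕ) (s t : ℝ) (i : ℕ) :
    dyadicPoint k s t (i + 1) - dyadicPoint k s t i = (t - s) / 2 ^ k := by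
  simp only [dyadicPoint]
  push_cast
  ring

lemma isPartition_dyadicPoint (k : ℕ) {s t : ℝ} (hst : s < t) :
    IsPartition s t (2 ^ k) (dyadicPoint k s t) := by
  refine ⟨by simp [dyadicPoint], ?_, fun i _ => ?_⟩
  · simp only [dyadicPoint]
    push_cast
    field_simp
    ring
  · have h : 0 < (t - s) / 2 ^ k := div_pos (sub_pos.2 hst) (by positivity)
    linarith [dyadicPoint_succ_sub k s t i]

lemma dyadicPoint_left (k : ℕ) (s t : ℝ) (i : ℕ) :
    dyadicPoint (k + 1) s t i = dyadicPoint k s ((s + t) / 2) i := by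
  simp only [dyadicPoint, pow_succ]
  field_simp
  ring

lemma dyadicPoint_right (k : ℕ) (s t : ℝ) (i : ℕ) :
    dyadicPoint (k + 1) s t (2 ^ k + i) = dyadicPoint k ((s + t) / 2) t i := by
  simp only [dyadicPoint, pow_succ]
  push_cast
  field_simp
  ring

/-- The sewing estimate along dyadic partitions. -/
lemma norm_dyadic_sum_sub_le {U : Type*} [NormedAddCommGroup U] {θ M T : ℝ} (hθ : 1 < θ)
    (hM : 0 ≤ M) {Ξ : ℝ → ℝ → U}
    (hΞ : ∀ s u t : ℝ, 0 ≤ s → s < u → u < t → t ≤ T →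
      ‖Ξ s t - Ξ s u - Ξ u t‖ ≤ M * (t - s) ^ θ) (k : ℕ) :
    ∀ s t : ℝ, 0 ≤ s → s < t → t ≤ T →
      ‖∑ i ∈ Finset.range (2 ^ k), Ξ (dyadicPoint k s t i) (dyadicPoint k s t (i + 1)) - Ξ s t‖ ≤
        M / (1 - 2 ^ (1 - θ)) * (t - s) ^ θ := by
  have hq : (2 : ℝ) ^ (1 - θ) < 1 := Real.rpow_lt_one_of_one_lt_of_neg (by norm_num) (by linarith)
  have hq' : 0 < 1 - (2 : ℝ) ^ (1 - θ) := by linarith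
  induction k with
  | zero =>
    intro s t _ hst _
    have h : 0 ≤ M / (1 - 2 ^ (1 - θ)) * (t - s) ^ θ :=
      mul_nonneg (div_nonneg hM hq'.le) (Real.rpow_nonneg (by linarith) _)
    simpa [dyadicPoint] using h
  | succ k ih =>
    intro s t hs hst ht
    set m := (s + t) / 2 with hm
    have hsm : s < m := by rw [hm]; linarith
    have hmt : m < t := by rw [hm]; linarith
    have hsum : ∑ i ∈ Finset.range (2 ^ (k + 1)),
          Ξ (dyadicPoint (k + 1) s t i) (dyadicPoint (k + 1) s t (i + 1)) =
        ∑ i ∈ Finset.range (2 ^ k), Ξ (dyadicPoint k s m i) (dyadicPoint k s m (i + 1)) +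
        ∑ i ∈ Finset.range (2 ^ k), Ξ (dyadicPoint k m t i) (dyadicPoint k m t (i + 1)) := by
      rw [pow_succ, mul_two, Finset.sum_range_add]
      simp only [add_assoc, dyadicPoint_right]
      simp only [dyadicPoint_left, hm]
    have h1 := ih s m hs hsm (by linarith)
    have h2 := ih m t (by linarith) hmt ht
    have h3 := hΞ s m t hs hsm hmt ht
    have hhalf : ((t - s) / 2) ^ θ = (t - s) ^ θ * (2 ^ (1 - θ) / 2) := by
      rw [Real.div_rpow (by linarith) (by norm_num), Real.rpow_sub (by norm_num), Real.rpow_one]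
      field_simp
    rw [show m - s = (t - s) / 2 by rw [hm]; ring, hhalf] at h1
    rw [show t - m = (t - s) / 2 by rw [hm]; ring, hhalf] at h2
    rw [hsum]
    set A := ∑ i ∈ Finset.range (2 ^ k), Ξ (dyadicPoint k s m i) (dyadicPoint k s m (i + 1))
    set B := ∑ i ∈ Finset.range (2 ^ k), Ξ (dyadicPoint k m t i) (dyadicPoint k m t (i + 1))
    calc ‖A + B - Ξ s t‖
        = ‖(A - Ξ s m) + (B - Ξ m t) - (Ξ s t - Ξ s m - Ξ m t)‖ := by congr 1; abel
      _ ≤ ‖A - Ξ s m‖ + ‖B - Ξ m t‖ + ‖Ξ s t - Ξ s m - Ξ m t‖ :=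
          (norm_sub_le _ _).trans (by gcongr; exact norm_add_le _ _)
      _ ≤ _ := add_le_add (add_le_add h1 h2) h3
      _ = M / (1 - 2 ^ (1 - θ)) * (t - s) ^ θ := by
          field_simp
          ring

end Sewing

section Holder

variable {E : Type*} [NormedAddCommGroup E] {T β : ℝ} {A B : ℝ → ℝ → E}

lemma hnorm_nonneg (T β : ℝ) (A : ℝ → ℝ → E) : 0 ≤ hnorm T β A :=
  Real.sInf_nonneg fun _ h => h.1

lemma HBound.sub (hA : HBound T β A) (hB : HBound T β B) :
    HBound T β fun s t => A s t - B s t := by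
  obtain ⟨C, hC⟩ := hA
  obtain ⟨D, hD⟩ := hB
  refine ⟨C + D, fun s t hs hst ht => (norm_sub_le _ _).trans ?_⟩
  rw [add_mul]
  exact add_le_add (hC s t hs hst ht) (hD s t hs hst ht)

/-- The Hölder seminorm is itself an admissible Hölder constant. -/
lemma HBound.norm_le (hA : HBound T β A) {s t : ℝ} (hs : 0 ≤ s) (hst : s < t) (ht : t ≤ T) :
    ‖A s t‖ ≤ hnorm T β A * (t - s) ^ β := by
  have hpos : 0 < (t - s) ^ β := Real.rpow_pos_of_pos (sub_pos.2 hst) _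
  rw [← div_le_iff₀ hpos]
  obtain ⟨C, hC⟩ := hA
  refine le_csInf ⟨max C 0, le_max_right _ _, fun s t hs hst ht => ?_⟩ fun D hD => ?_
  · exact (hC s t hs hst ht).trans
      (mul_le_mul_of_nonneg_right (le_max_left _ _) (Real.rpow_nonneg (by linarith) _))
  · rw [div_le_iff₀ hpos]
    exact hD.2 s t hs hst ht

end Holder

/-- `x` and `y` have norm at most `A * w`, and their difference has norm at most `D * w`. -/
structure PairBound {E : Type*} [NormedAddCommGroup E] (w A D : ℝ) (x y : E) : Prop where
  left : ‖x‖ ≤ A * w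
  right : ‖y‖ ≤ A * w
  diff : ‖x - y‖ ≤ D * w

namespace PairBound

section Holder

variable {E : Type*} [NormedAddCommGroup E] {w A D : ℝ}

lemma of_hnorm {T β : ℝ} {P Q : ℝ → ℝ → E} (hP : HBound T β P) (hQ : HBound T β Q)
    (hPA : hnorm T β P ≤ A) (hQA : hnorm T β Q ≤ A)
    (hPQ : hnorm T β (fun s t => P s t - Q s t) ≤ D) {s t : ℝ} (hs : 0 ≤ s) (hst : s < t)
    (ht : t ≤ T) (hw : (t - s) ^ β ≤ w) : PairBound w A D (P s t) (Q s t) := by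
  have hpos : 0 ≤ (t - s) ^ β := Real.rpow_nonneg (by linarith) _
  refine ⟨(hP.norm_le hs hst ht).trans ?_, (hQ.norm_le hs hst ht).trans ?_,
    ((hP.sub hQ).norm_le hs hst ht).trans ?_⟩
  · exact mul_le_mul hPA hw hpos ((hnorm_nonneg T β P).trans hPA)
  · exact mul_le_mul hQA hw hpos ((hnorm_nonneg T β Q).trans hQA)
  · exact mul_le_mul hPQ hw hpos ((hnorm_nonneg T β _).trans hPQ)

/-- Pointwise bounds on a Hölder path from bounds on its initial value and its increments. -/
lemma of_increments {T α K Δ : ℝ} (hα : 0 ≤ α) {f g : ℝ → E}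
    (hf : HBound T α fun s t => f t - f s) (hg : HBound T α fun s t => g t - g s)
    (hfK : hnorm T α (fun s t => f t - f s) ≤ K) (hgK : hnorm T α (fun s t => g t - g s) ≤ K)
    (hfg : ‖f 0 - g 0‖ + hnorm T α (fun s t => (f t - f s) - (g t - g s)) ≤ Δ)
    (hf0 : ‖f 0‖ ≤ K) (hg0 : ‖g 0‖ ≤ K) {s : ℝ} (hs : 0 ≤ s) (hsT : s ≤ T) :
    PairBound 1 (K * (1 + T ^ α)) (Δ * (1 + T ^ α)) (f s) (g s) := by
  have hTα : 0 ≤ T ^ α := Real.rpow_nonneg (hs.trans hsT) _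
  have hK : 0 ≤ K := (norm_nonneg _).trans hf0
  have hn := hnorm_nonneg T α (fun s t => (f t - f s) - (g t - g s))
  have hΔ : 0 ≤ Δ := le_trans (by positivity) hfg
  rcases hs.eq_or_lt with rfl | hs
  · refine ⟨?_, ?_, ?_⟩ <;> nlinarith [norm_nonneg (f 0 - g 0)]
  have hsα : s ^ α ≤ T ^ α := Real.rpow_le_rpow hs.le hsT hα
  have h := of_hnorm hf hg hfK hgK le_rfl le_rfl hs hsT (w := T ^ α) (by simpa using hsα)
  refine ⟨?_, ?_, ?_⟩
  · nlinarith [h.left, norm_add_le (f 0) (f s - f 0), congrArg norm (add_sub_cancel (f 0) (f s))]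
  · nlinarith [h.right, norm_add_le (g 0) (g s - g 0), congrArg norm (add_sub_cancel (g 0) (g s))]
  · have h1 : ‖f s - g s‖ ≤ ‖f 0 - g 0‖ + ‖(f s - f 0) - (g s - g 0)‖ := by
      refine le_of_eq_of_le ?_ (norm_add_le _ _)
      congr 1
      abel
    nlinarith [h.diff, norm_nonneg (f 0 - g 0)]

end Holder

section Bilinear

variable {E F G : Type*} [NormedAddCommGroup E] [NormedSpace ℝ E]
  [NormedAddCommGroup F] [NormedSpace ℝ F] [NormedAddCommGroup G] [NormedSpace ℝ G]
  {w w' A A' D D' : ℝ}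

lemma bilin (b : E →L[ℝ] F →L[ℝ] G) (hb : ∀ x y, ‖b x y‖ ≤ ‖x‖ * ‖y‖) {x x' : E} {y y' : F}
    (hx : PairBound w A D x x') (hy : PairBound w' A' D' y y') :
    PairBound (w * w') (A * A') (D * A' + A * D') (b x y) (b x' y') := by
  have hA := (norm_nonneg _).trans hx.left
  have hD := (norm_nonneg _).trans hx.diff
  refine ⟨(hb _ _).trans ?_, (hb _ _).trans ?_, ?_⟩
  · calc ‖x‖ * ‖y‖ ≤ (A * w) * (A' * w') := by gcongr; exacts [hx.left, hy.left]
      _ = _ := by ring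
  · calc ‖x'‖ * ‖y'‖ ≤ (A * w) * (A' * w') := by gcongr; exacts [hx.right, hy.right]
      _ = _ := by ring
  · calc ‖b x y - b x' y'‖ = ‖b (x - x') y + b x' (y - y')‖ := by
          congr 1
          simp only [map_sub, sub_apply]
          abel
      _ ≤ ‖x - x'‖ * ‖y‖ + ‖x'‖ * ‖y - y'‖ :=
          (norm_add_le _ _).trans (add_le_add (hb _ _) (hb _ _))
      _ ≤ (D * w) * (A' * w') + (A * w) * (D' * w') := by
          gcongr
          exacts [hx.diff, hy.left, hx.right, hy.diff]
      _ = _ := by ring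

lemma apply {f f' : E →L[ℝ] F} {x x' : E} (hf : PairBound w A D f f')
    (hx : PairBound w' A' D' x x') :
    PairBound (w * w') (A * A') (D * A' + A * D') (f x) (f' x') :=
  bilin (ContinuousLinearMap.id ℝ (E →L[ℝ] F)) (fun g y => g.le_opNorm y) hf hx

end Bilinear

end PairBound

section Germ

variable {V V2 W U : Type*}
  [NormedAddCommGroup V] [NormedSpace ℝ V] [NormedAddCommGroup V2] [NormedSpace ℝ V2]
  [NormedAddCommGroup W] [NormedSpace ℝ W] [NormedAddCommGroup U] [NormedSpace ℝ U]

/-- The germ `Y_s(Z_{s,t}) + (Y'_s ⋆ Z'_s)(𝕏_{s,t})` of the rough integral. -/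
noncomputable def germ (tops : TensorOps V V2 W U) (XX : ℝ → ℝ → V2)
    (Y : ℝ → W →L[ℝ] U) (Y' : ℝ → V →L[ℝ] (W →L[ℝ] U))
    (Z : ℝ → W) (Z' : ℝ → V →L[ℝ] W) (s t : ℝ) : U :=
  Y s (Z t - Z s) + tops.spair (Y' s) (Z' s) (XX s t)

lemma germ_defect (tops : TensorOps V V2 W U) {X : ℝ → V} {XX : ℝ → ℝ → V2}
    (Y : ℝ → W →L[ℝ] U) (Y' : ℝ → V →L[ℝ] (W →L[ℝ] U))
    (Z : ℝ → W) (Z' : ℝ → V →L[ℝ] W) {s u t : ℝ}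
    (chen : XX s t = XX s u + XX u t + tops.tmul (X u - X s) (X t - X u)) :
    germ tops XX Y Y' Z Z' s t - germ tops XX Y Y' Z Z' s u - germ tops XX Y Y' Z Z' u t =
      -(Y' s (X u - X s) ((Z' u - Z' s) (X t - X u)) + Y' s (X u - X s) (Rem X Z Z' u t) +
        Rem X Y Y' s u (Z' u (X t - X u)) + Rem X Y Y' s u (Rem X Z Z' u t) +
        tops.spair (Y' u - Y' s) (Z' u) (XX u t) + tops.spair (Y' s) (Z' u - Z' s) (XX u t)) := by
  simp only [germ, chen, Rem, map_add, tops.spair_tmul, map_sub, sub_apply]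
  abel

end Germ

/-- stability of the rough integral with respect to all data. -/
theorem stmt16
    {V V2 W U : Type*} [NormedAddCommGroup V] [NormedSpace ℝ V] [CompleteSpace V]
    [NormedAddCommGroup V2] [NormedSpace ℝ V2] [CompleteSpace V2]
    [NormedAddCommGroup W] [NormedSpace ℝ W] [CompleteSpace W]
    [NormedAddCommGroup U] [NormedSpace ℝ U] [CompleteSpace U]
    (T α : ℝ) (hT : 0 < T) (hα : 1 / 3 < α) (hα' : α ≤ 1 / 2)
    (tops : TensorOps V V2 W U) :
    ∀ K : ℝ, 0 < K → ∃ C : ℝ, 0 < C ∧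
      ∀ (X Xt : ℝ → V) (XX XXt : ℝ → ℝ → V2),
        IsRoughPath T α tops.tmul X XX → IsRoughPath T α tops.tmul Xt XXt →
        rpNorm T α X XX ≤ K → rpNorm T α Xt XXt ≤ K →
      ∀ (Y Yt : ℝ → W →L[ℝ] U) (Y' Yt' : ℝ → V →L[ℝ] (W →L[ℝ] U)),
        IsCRP T α X Y Y' → IsCRP T α Xt Yt Yt' →
      ∀ (Z Zt : ℝ → W) (Z' Zt' : ℝ → V →L[ℝ] W),
        IsCRP T α X Z Z' → IsCRP T α Xt Zt Zt' →
        ‖Y' 0‖ ≤ K → ‖Yt' 0‖ ≤ K → ‖Z' 0‖ ≤ K → ‖Zt' 0‖ ≤ K →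
        crpNorm T α X Y Y' ≤ K → crpNorm T α Xt Yt Yt' ≤ K →
        crpNorm T α X Z Z' ≤ K → crpNorm T α Xt Zt Zt' ≤ K →
      ∀ s t : ℝ, 0 ≤ s → s ≤ t → t ≤ T →
      ∀ I It : U, IsRoughIntegral tops XX Y Y' Z Z' s t I →
        IsRoughIntegral tops XXt Yt Yt' Zt Zt' s t It →
        ‖(I - It) - ((Y s) (Z t - Z s) + (tops.spair (Y' s) (Z' s)) (XX s t)) +
            ((Yt s) (Zt t - Zt s) + (tops.spair (Yt' s) (Zt' s)) (XXt s t))‖ ≤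
          C * (crpDist T α X Xt Y Y' Yt Yt' + crpDist T α X Xt Z Z' Zt Zt' +
              ‖Y' 0 - Yt' 0‖ + ‖Z' 0 - Zt' 0‖ + rpDist T α X Xt XX XXt) *
            (t - s) ^ (3 * α) := by
  intro K hK
  have hα0 : 0 ≤ α := by linarith
  have hτ : 0 < T ^ α := Real.rpow_pos_of_pos hT _
  set N := 1 + T ^ α with hN
  set L := K * N with hL
  have hN1 : 1 ≤ N := by linarith
  have hKL : K ≤ L := le_mul_of_one_le_right hK.le hN1
  have hL0 : 0 < L := hK.trans_le hKL
  have hq : (2 : ℝ) ^ (1 - 3 * α) < 1 :=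
    Real.rpow_lt_one_of_one_lt_of_neg (by norm_num) (by linarith)
  have hq' : 0 < 1 - (2 : ℝ) ^ (1 - 3 * α) := by linarith
  set C₀ := N * (4 * L ^ 3 + 12 * L ^ 2 + 2 * L * T ^ α) with hC₀
  have hC₀pos : 0 < C₀ := by positivity
  refine ⟨C₀ / (1 - 2 ^ (1 - 3 * α)), by positivity, ?_⟩
  intro X Xt XX XXt hX hXt hXK hXtK Y Yt Y' Yt' hY hYt Z Zt Z' Zt' hZ hZt
    hY0 hYt0 hZ0 hZt0 hYK hYtK hZK hZtK s t hs hst ht I It hI hIt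
  set Δ := crpDist T α X Xt Y Y' Yt Yt' + crpDist T α X Xt Z Z' Zt Zt' +
    ‖Y' 0 - Yt' 0‖ + ‖Z' 0 - Zt' 0‖ + rpDist T α X Xt XX XXt with hΔ
  rcases hst.eq_or_lt with rfl | hst
  · have trivial_integral : ∀ {J : U} {QQ : ℝ → ℝ → V2} {A : ℝ → W →L[ℝ] U}
        {A' : ℝ → V →L[ℝ] (W →L[ℝ] U)} {B : ℝ → W} {B' : ℝ → V →L[ℝ] W},
        IsRoughIntegral tops QQ A A' B B' s s J → J = 0 := by
      intro J QQ A A' B B' hJ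
      refine norm_le_zero_iff.1 (le_of_forall_pos_le_add fun ε hε => ?_)
      obtain ⟨δ, -, h⟩ := hJ ε hε
      simpa [rsum] using h 0 (fun _ => s) ⟨rfl, rfl, by simp⟩ (by simp)
    have h1 : XX s s = 0 := by simpa using hX.chen s s s hs le_rfl le_rfl ht
    have h2 : XXt s s = 0 := by simpa using hXt.chen s s s hs le_rfl le_rfl ht
    have h3 : (0 : ℝ) ^ (3 * α) = 0 := Real.zero_rpow (by linarith)
    simp [trivial_integral hI, trivial_integral hIt, h1, h2, h3]
  simp only [rpNorm, crpNorm] at hXK hXtK hYK hYtK hZK hZtK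
  simp only [rpDist, crpDist] at hΔ
  have p1 := hnorm_nonneg T (2 * α) (fun s t => Rem X Y Y' s t - Rem Xt Yt Yt' s t)
  have p2 := hnorm_nonneg T (2 * α) (fun s t => Rem X Z Z' s t - Rem Xt Zt Zt' s t)
  have p3 := hnorm_nonneg T α (fun s t => (Y' t - Y' s) - (Yt' t - Yt' s))
  have p4 := hnorm_nonneg T α (fun s t => (Z' t - Z' s) - (Zt' t - Zt' s))
  have p5 := hnorm_nonneg T α (fun s t => (X t - X s) - (Xt t - Xt s))
  have p6 := hnorm_nonneg T (2 * α) (fun s t => XX s t - XXt s t)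
  have p7 := norm_nonneg (Y' 0 - Yt' 0)
  have p8 := norm_nonneg (Z' 0 - Zt' 0)
  have q1 := hnorm_nonneg T (2 * α) (Rem X Y Y')
  have q2 := hnorm_nonneg T (2 * α) (Rem Xt Yt Yt')
  have q3 := hnorm_nonneg T (2 * α) (Rem X Z Z')
  have q4 := hnorm_nonneg T (2 * α) (Rem Xt Zt Zt')
  have q5 := hnorm_nonneg T α (fun s t => Y' t - Y' s)
  have q6 := hnorm_nonneg T α (fun s t => Yt' t - Yt' s)
  have q7 := hnorm_nonneg T α (fun s t => Z' t - Z' s)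
  have q8 := hnorm_nonneg T α (fun s t => Zt' t - Zt' s)
  have q9 := hnorm_nonneg T α (fun s t => X t - X s)
  have q10 := hnorm_nonneg T α (fun s t => Xt t - Xt s)
  have q11 := hnorm_nonneg T (2 * α) XX
  have q12 := hnorm_nonneg T (2 * α) XXt
  have hΔ0 : 0 ≤ Δ := by linarith
  have hD : Δ ≤ Δ * N := le_mul_of_one_le_right hΔ0 hN1
  set D := Δ * N with hDdef
  set Ξ : ℝ → ℝ → U := fun s t => germ tops XX Y Y' Z Z' s t - germ tops XXt Yt Yt' Zt Zt' s t
    with hΞ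
  have defect : ∀ s u t : ℝ, 0 ≤ s → s < u → u < t → t ≤ T →
      ‖Ξ s t - Ξ s u - Ξ u t‖ ≤ C₀ * Δ * (t - s) ^ (3 * α) := by
    intro s u t hs hsu hut ht
    have hts : 0 ≤ t - s := by linarith
    set a := (t - s) ^ α with ha
    have ha0 : 0 ≤ a := Real.rpow_nonneg hts _
    have ha2 : (t - s) ^ (2 * α) = a ^ 2 := by
      rw [ha, mul_comm, Real.rpow_mul hts]; norm_cast
    have ha3 : (t - s) ^ (3 * α) = a ^ 3 := by
      rw [ha, mul_comm, Real.rpow_mul hts]; norm_cast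
    have haT : a ≤ T ^ α := Real.rpow_le_rpow hts (by linarith) hα0
    have w1 : (u - s) ^ α ≤ a := Real.rpow_le_rpow (by linarith) (by linarith) hα0
    have w2 : (t - u) ^ α ≤ a := Real.rpow_le_rpow (by linarith) (by linarith) hα0
    have w3 : (u - s) ^ (2 * α) ≤ a ^ 2 :=
      ha2 ▸ Real.rpow_le_rpow (by linarith) (by linarith) (by linarith)
    have w4 : (t - u) ^ (2 * α) ≤ a ^ 2 :=
      ha2 ▸ Real.rpow_le_rpow (by linarith) (by linarith) (by linarith)
    have hu0 : 0 ≤ u := by linarith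
    have huT : u ≤ T := by linarith
    have bXsu : PairBound a L D (X u - X s) (Xt u - Xt s) :=
      .of_hnorm hX.x_hold hXt.x_hold (by linarith) (by linarith) (by linarith) hs hsu huT w1
    have bXut : PairBound a L D (X t - X u) (Xt t - Xt u) :=
      .of_hnorm hX.x_hold hXt.x_hold (by linarith) (by linarith) (by linarith) hu0 hut ht w2
    have bXX : PairBound (a ^ 2) L D (XX u t) (XXt u t) :=
      .of_hnorm hX.xx_hold hXt.xx_hold (by linarith) (by linarith) (by linarith) hu0 hut ht w4
    have bRY : PairBound (a ^ 2) L D (Rem X Y Y' s u) (Rem Xt Yt Yt' s u) :=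
      .of_hnorm hY.rem_hold hYt.rem_hold (by linarith) (by linarith) (by linarith) hs hsu huT w3
    have bRZ : PairBound (a ^ 2) L D (Rem X Z Z' u t) (Rem Xt Zt Zt' u t) :=
      .of_hnorm hZ.rem_hold hZt.rem_hold (by linarith) (by linarith) (by linarith) hu0 hut ht w4
    have bYsu : PairBound a L D (Y' u - Y' s) (Yt' u - Yt' s) :=
      .of_hnorm hY.deriv_hold hYt.deriv_hold (by linarith) (by linarith) (by linarith)
        hs hsu huT w1
    have bZsu : PairBound a L D (Z' u - Z' s) (Zt' u - Zt' s) :=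
      .of_hnorm hZ.deriv_hold hZt.deriv_hold (by linarith) (by linarith) (by linarith)
        hs hsu huT w1
    have bY : PairBound 1 L D (Y' s) (Yt' s) :=
      .of_increments hα0 hY.deriv_hold hYt.deriv_hold (by linarith) (by linarith) (by linarith)
        hY0 hYt0 hs (by linarith)
    have bZ : PairBound 1 L D (Z' u) (Zt' u) :=
      .of_increments hα0 hZ.deriv_hold hZt.deriv_hold (by linarith) (by linarith) (by linarith)
        hZ0 hZt0 hu0 huT
    have spair_le : ∀ A B, ‖tops.spair A B‖ ≤ ‖A‖ * ‖B‖ := tops.spair_le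
    have t1 := ((bY.apply bXsu).apply (bZsu.apply bXut)).diff
    have t2 := ((bY.apply bXsu).apply bRZ).diff
    have t3 := (bRY.apply (bZ.apply bXut)).diff
    have t4 := (bRY.apply bRZ).diff
    have t5 := ((bYsu.bilin tops.spair spair_le bZ).apply bXX).diff
    have t6 := ((bY.bilin tops.spair spair_le bZsu).apply bXX).diff
    have hsplit : Ξ s t - Ξ s u - Ξ u t =
        (germ tops XX Y Y' Z Z' s t - germ tops XX Y Y' Z Z' s u - germ tops XX Y Y' Z Z' u t) -
        (germ tops XXt Yt Yt' Zt Zt' s t - germ tops XXt Yt Yt' Zt Zt' s u -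
          germ tops XXt Yt Yt' Zt Zt' u t) := by
      simp only [hΞ]
      abel
    rw [hsplit, germ_defect tops Y Y' Z Z' (hX.chen s u t hs hsu.le hut.le ht),
      germ_defect tops Yt Yt' Zt Zt' (hXt.chen s u t hs hsu.le hut.le ht), neg_sub_neg,
      norm_sub_rev, add_sub_add_comm, add_sub_add_comm, add_sub_add_comm, add_sub_add_comm,
      add_sub_add_comm, ha3]
    have hD0 : 0 ≤ D := hΔ0.trans hD
    have h4 : 2 * L * D * a ^ 3 * a ≤ 2 * L * D * a ^ 3 * T ^ α := by gcongr
    calc _ ≤ _ := norm_add_le_of_le (norm_add_le_of_le (norm_add_le_of_le (norm_add_le_of_le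
          (norm_add_le_of_le t1 t2) t3) t4) t5) t6
      _ = D * (4 * L ^ 3 + 12 * L ^ 2) * a ^ 3 + 2 * L * D * a ^ 3 * a := by ring
      _ ≤ D * (4 * L ^ 3 + 12 * L ^ 2) * a ^ 3 + 2 * L * D * a ^ 3 * T ^ α := by gcongr
      _ = C₀ * Δ * a ^ 3 := by rw [hC₀, hDdef]; ring
  refine le_of_forall_pos_le_add fun ε hε => ?_
  obtain ⟨δ, hδ, h1⟩ := hI (ε / 2) (by positivity)
  obtain ⟨δt, hδt, h2⟩ := hIt (ε / 2) (by positivity)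
  obtain ⟨k, hk⟩ : ∃ k : ℕ, (t - s) / 2 ^ k < min δ δt := by
    obtain ⟨k, hk⟩ := pow_unbounded_of_one_lt ((t - s) / min δ δt) (one_lt_two (α := ℝ))
    refine ⟨k, ?_⟩
    rw [div_lt_iff₀ (lt_min hδ hδt)] at hk
    rw [div_lt_iff₀ (by positivity)]
    linarith
  have hp := isPartition_dyadicPoint k hst
  have h1 := h1 _ _ hp fun i _ => by
    rw [dyadicPoint_succ_sub]; exact hk.trans_le (min_le_left _ _)
  have h2 := h2 _ _ hp fun i _ => by
    rw [dyadicPoint_succ_sub]; exact hk.trans_le (min_le_right _ _)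
  have h3 := norm_dyadic_sum_sub_le (by linarith : 1 < 3 * α) (by positivity) defect k s t hs hst ht
  have hsum : ∑ i ∈ Finset.range (2 ^ k), Ξ (dyadicPoint k s t i) (dyadicPoint k s t (i + 1)) =
      rsum tops XX Y Y' Z Z' (2 ^ k) (dyadicPoint k s t) -
        rsum tops XXt Yt Yt' Zt Zt' (2 ^ k) (dyadicPoint k s t) :=
    Finset.sum_sub_distrib _ _
  rw [hsum] at h3
  set S := rsum tops XX Y Y' Z Z' (2 ^ k) (dyadicPoint k s t)
  set St := rsum tops XXt Yt Yt' Zt Zt' (2 ^ k) (dyadicPoint k s t)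
  calc _ = ‖(S - St - Ξ s t) - (S - I) + (St - It)‖ := by
        congr 1
        simp only [hΞ, germ]
        abel
    _ ≤ C₀ * Δ / (1 - 2 ^ (1 - 3 * α)) * (t - s) ^ (3 * α) + ε / 2 + ε / 2 :=
        norm_add_le_of_le (norm_sub_le_of_le h3 h1) h2
    _ = C₀ / (1 - 2 ^ (1 - 3 * α)) * Δ * (t - s) ^ (3 * α) + ε := by ring
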